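/- Let (X,d) be a proper length metric space, K : X → [0,∞) continuous with Σ := {K = 0} finite, and suppose K(x) ≥ k(d(x,Σ)) for some continuous k : [0,∞) → [0,∞) with ∫_0^∞ k(t) dt = +∞. Then for every piecewise locally Lipschitz curve γ : I → X one has L_K(γ) = L_{d_K}(γ), where L_{d_K}(γ) is the length of γ computed in the metric space (X, d_K). -/

import Mathlib

open Filter Topology MeasureTheory Set
open scoped ENNReal NNReal Classical

section Defs

variable {X : Type*} [MetricSpace X]

/-- The metric derivative of the curve `γ` within the set `I` at the point `t` exists and has
value `L`, i.e. `lim_{s → t, s ∈ I} dist (γ s) (γ t) / |s - t| = L`. -/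
def HasMetricDerivWithinAt (γ : ℝ → X) (I : Set ℝ) (t : ℝ) (L : ℝ) : Prop :=
  Tendsto (fun s => dist (γ s) (γ t) / |s - t|) (𝓝[I \ {t}] t) (𝓝 L)

/-- The metric derivative `|γ̇|(t)` of `γ` within `I` at `t` (junk value `0` if the defining
limit does not exist). -/
noncomputable def metricDerivWithin (γ : ℝ → X) (I : Set ℝ) (t : ℝ) : ℝ :=
  if h : ∃ L, HasMetricDerivWithinAt γ I t L then h.choose else 0

/-- `γ` is locally Lipschitz on the set `s ⊆ ℝ`. -/
def LocallyLipschitzOnSet (γ : ℝ → X) (s : Set ℝ) : Prop :=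
  ∀ t ∈ s, ∃ ε > 0, ∃ C : NNReal, LipschitzOnWith C γ (s ∩ Metric.ball t ε)

/-- `γ` is a piecewise locally Lipschitz curve on the interval `I`: it is continuous on `I`
and locally Lipschitz outside finitely many points of `I` (equivalently, there are
`t_0 = inf I < t_1 < ⋯ < t_n = sup I` such that `γ` is locally Lipschitz on each
`I ∩ (t_i, t_(i+1))`). -/
def PiecewiseLocLipOn (γ : ℝ → X) (I : Set ℝ) : Prop :=
  ContinuousOn γ I ∧ ∃ S : Finset ℝ, LocallyLipschitzOnSet γ (I \ ↑S)

/-- The `K`-weighted length `L_K(γ) = ∫_I K (γ t) * |γ̇| t dt` of a curve `γ` defined on `I`. -/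
noncomputable def KLength (K : X → ℝ) (γ : ℝ → X) (I : Set ℝ) : ℝ≥0∞ :=
  ∫⁻ t in I, ENNReal.ofReal (K (γ t) * metricDerivWithin γ I t)

/-- The filter of approach to the left endpoint of the interval `I` (the endpoint may be
`-∞`, i.e. `I` may be unbounded below). -/
noncomputable def leftEndFilter (I : Set ℝ) : Filter ℝ :=
  if BddBelow I then 𝓝[I] (sInf I) else Filter.atBot ⊓ Filter.principal I

/-- The filter of approach to the right endpoint of the interval `I`. -/
noncomputable def rightEndFilter (I : Set ℝ) : Filter ℝ :=
  if BddAbove I then 𝓝[I] (sSup I) else Filter.atTop ⊓ Filter.principal I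

/-- `γ`, defined on the nonempty interval `I`, is a path from `x` to `y`: it is continuous on
`I` and converges to `x` (resp. `y`) at the left (resp. right) endpoint of `I` (where the
value at an infinite endpoint is understood as a limit). -/
def IsPathOn (γ : ℝ → X) (I : Set ℝ) (x y : X) : Prop :=
  I.Nonempty ∧ I.OrdConnected ∧ ContinuousOn γ I ∧
    Tendsto γ (leftEndFilter I) (𝓝 x) ∧ Tendsto γ (rightEndFilter I) (𝓝 y)

/-- The weighted (pseudo-)distance `d_K(x,y)`: the infimum of `L_K` over piecewise locally
Lipschitz paths from `x` to `y`. -/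
noncomputable def dK (K : X → ℝ) (x y : X) : ℝ≥0∞ :=
  ⨅ (γ : ℝ → X) (I : Set ℝ) (_ : PiecewiseLocLipOn γ I) (_ : IsPathOn γ I x y),
    KLength K γ I

/-- The intrinsic (geodesic) distance: the infimum of the length `L_d(γ) = eVariationOn γ I`
over all paths from `x` to `y`. -/
noncomputable def geodDist (x y : X) : ℝ≥0∞ :=
  ⨅ (γ : ℝ → X) (I : Set ℝ) (_ : IsPathOn γ I x y), eVariationOn γ I

/-- A length space: the distance coincides with the intrinsic distance. -/
def IsLengthSpace (Y : Type*) [MetricSpace Y] : Prop :=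
  ∀ x y : Y, geodDist x y = edist x y

/-- `K_r(x) := inf { K z : dist x z ≤ r }`. -/
noncomputable def Kinf (K : X → ℝ) (x : X) (r : ℝ) : ℝ :=
  sInf (K '' Metric.closedBall x r)

/-- `K^r(x) := sup { K z : dist x z ≤ r }`. -/
noncomputable def Ksup (K : X → ℝ) (x : X) (r : ℝ) : ℝ :=
  sSup (K '' Metric.closedBall x r)

/-- The energy `E_W(γ) = ∫_I (½ |γ̇|(t)² + W (γ t)) dt`. -/
noncomputable def energyW (W : X → ℝ) (γ : ℝ → X) (I : Set ℝ) : ℝ≥0∞ :=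
  ∫⁻ t in I, ENNReal.ofReal ((metricDerivWithin γ I t) ^ 2 / 2 + W (γ t))

end Defs

/-- The length of the curve `γ : I → X` computed in the metric space `(X, d_K)`: the supremum
of `∑ d_K (γ t_i) (γ t_(i+1))` over all finite monotone sequences in `I`. -/
noncomputable def dKVariationOn {X : Type*} [MetricSpace X] (K : X → ℝ)
    (γ : ℝ → X) (I : Set ℝ) : ℝ≥0∞ :=
  ⨆ p : ℕ × { u : ℕ → ℝ // Monotone u ∧ ∀ i, u i ∈ I },
    ∑ i ∈ Finset.range p.1, dK K (γ (p.2.1 (i + 1))) (γ (p.2.1 i))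

section MetricDerivative

variable {X : Type*} [MetricSpace X]

/-- A Lipschitz curve in a separable metric space has a metric derivative almost everywhere. -/
theorem LipschitzWith.ae_exists_tendsto_dist_div [SecondCountableTopology X] {γ : ℝ → X}
    {C : ℝ≥0} (hγ : LipschitzWith C γ) :
    ∀ᵐ t, ∃ L, Tendsto (fun s => dist (γ s) (γ t) / |s - t|) (𝓝[≠] t) (𝓝 L) := by
  have : Nonempty X := ⟨γ 0⟩
  set φ : ℕ → ℝ → ℝ := fun n t => dist (γ t) (TopologicalSpace.denseSeq X n) with hφ
  have hφL : ∀ n, LipschitzWith C (φ n) := fun n => by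
    have h := (LipschitzWith.dist_left (TopologicalSpace.denseSeq X n)).comp hγ
    rwa [one_mul] at h
  set m : ℝ → ℝ := fun t => ⨆ n, |deriv (φ n) t| with hm
  have hbound : ∀ n t, |deriv (φ n) t| ≤ C := fun n t => by
    simpa using norm_deriv_le_of_lipschitz (hφL n) (x₀ := t)
  have hbdd : ∀ t, BddAbove (range fun n => |deriv (φ n) t|) := fun t =>
    ⟨C, by rintro _ ⟨n, rfl⟩; exact hbound n t⟩
  have hle_m : ∀ n t, |deriv (φ n) t| ≤ m t := fun n t => le_ciSup (hbdd t) n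
  have hm0 : ∀ t, 0 ≤ m t := fun t => (abs_nonneg _).trans (hle_m 0 t)
  have hmC : ∀ t, m t ≤ C := fun t => ciSup_le fun n => hbound n t
  have hmm : Measurable m := Measurable.iSup fun n => (measurable_deriv (φ n)).abs
  have hmint : LocallyIntegrable m volume := by
    refine (locallyIntegrable_const (C : ℝ)).mono hmm.aestronglyMeasurable (.of_forall fun t => ?_)
    simpa [abs_of_nonneg (hm0 t)] using hmC t
  have hmi : ∀ a b, IntervalIntegrable m volume a b := fun a b =>
    intervalIntegrable_iff.mpr <|
      (hmint.integrableOn_isCompact isCompact_uIcc).mono_set uIoc_subset_uIcc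
  have hinc : ∀ n s t, |φ n t - φ n s| ≤ |∫ u in s..t, m u| := fun n s t => by
    have hac := ((hφL n).lipschitzOnWith (s := uIcc s t)).absolutelyContinuousOnInterval
    rw [← hac.integral_deriv_eq_sub, ← Real.norm_eq_abs]
    refine (intervalIntegral.norm_integral_le_abs_of_norm_le (g := m) ?_ (hmi s t))
    exact .of_forall fun u => hle_m n u
  have hdist : ∀ s t, dist (γ t) (γ s) ≤ |∫ u in s..t, m u| := fun s t => by
    have : ∀ x, |dist (γ t) x - dist (γ s) x| ≤ |∫ u in s..t, m u| := fun x => by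
      refine isClosed_property (TopologicalSpace.denseRange_denseSeq X)
        (p := fun x => |dist (γ t) x - dist (γ s) x| ≤ |∫ u in s..t, m u|)
        (isClosed_le (by fun_prop) continuous_const) (fun n => hinc n s t) x
    simpa using this (γ s)
  have hdiff : ∀ᵐ t, ∀ n, DifferentiableAt ℝ (φ n) t :=
    ae_all_iff.2 fun n => (hφL n).ae_differentiableAt_real
  filter_upwards [hdiff, LocallyIntegrable.ae_hasDerivAt_integral hmint] with t hd hM
  refine ⟨m t, tendsto_order.2 ⟨fun a ha => ?_, fun a ha => ?_⟩⟩
  · obtain ⟨n, hn⟩ := exists_lt_of_lt_ciSup ha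
    have h1 := ((hd n).hasDerivAt.tendsto_slope).abs
    filter_upwards [h1.eventually (lt_mem_nhds hn)] with s hs
    refine hs.trans_le ?_
    rw [slope_def_field, abs_div]
    gcongr
    exact abs_dist_sub_le _ _ _
  · have h1 := ((hM t).tendsto_slope).abs
    rw [abs_of_nonneg (hm0 t)] at h1
    filter_upwards [h1.eventually (gt_mem_nhds ha)] with s hs
    refine lt_of_le_of_lt ?_ hs
    rw [slope_def_field, abs_div]
    gcongr
    simpa using hdist t s

theorem nhdsWithin_sdiff_singleton_of_mem_nhds {I : Set ℝ} {t : ℝ} (hI : I ∈ 𝓝 t) :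
    𝓝[I \ {t}] t = 𝓝[≠] t := by
  rw [sdiff_eq, inter_comm, nhdsWithin_inter_of_mem' (mem_nhdsWithin_of_mem_nhds hI)]

theorem HasMetricDerivWithinAt.tendsto {γ : ℝ → X} {I : Set ℝ} {t L : ℝ}
    (hI : I ∈ 𝓝 t) (h : HasMetricDerivWithinAt γ I t L) :
    Tendsto (fun s => dist (γ s) (γ t) / |s - t|) (𝓝[≠] t) (𝓝 L) := by
  rwa [HasMetricDerivWithinAt, nhdsWithin_sdiff_singleton_of_mem_nhds hI] at h

theorem HasMetricDerivWithinAt.nonneg {γ : ℝ → X} {I : Set ℝ} {t L : ℝ}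
    (hI : I ∈ 𝓝 t) (h : HasMetricDerivWithinAt γ I t L) : 0 ≤ L :=
  ge_of_tendsto' (h.tendsto hI) fun s => by positivity

theorem hasMetricDerivWithinAt_metricDerivWithin {γ : ℝ → X} {I : Set ℝ} {t : ℝ}
    (h : ∃ L, HasMetricDerivWithinAt γ I t L) :
    HasMetricDerivWithinAt γ I t (metricDerivWithin γ I t) := by
  rw [metricDerivWithin, dif_pos h]
  exact h.choose_spec

theorem metricDerivWithin_nonneg {γ : ℝ → X} {I : Set ℝ} {t : ℝ} (hI : I ∈ 𝓝 t) :
    0 ≤ metricDerivWithin γ I t := by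
  by_cases h : ∃ L, HasMetricDerivWithinAt γ I t L
  · exact (hasMetricDerivWithinAt_metricDerivWithin h).nonneg hI
  · rw [metricDerivWithin, dif_neg h]

theorem Set.OrdConnected.ae_mem_nhds {I : Set ℝ} (hI : I.OrdConnected) :
    ∀ᵐ t, t ∈ I → I ∈ 𝓝 t := by
  have h := hI.convex.addHaar_frontier (volume : Measure ℝ)
  filter_upwards [measure_eq_zero_iff_ae_notMem.1 h] with t ht htI
  rw [← mem_interior_iff_mem_nhds]
  by_contra hn
  exact ht ⟨subset_closure htI, hn⟩

/-- A piecewise locally Lipschitz curve in a separable metric space has a metric derivative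
almost everywhere. -/
theorem PiecewiseLocLipOn.ae_exists_hasMetricDerivWithinAt [SecondCountableTopology X]
    {γ : ℝ → X} {I : Set ℝ} (hI : I.OrdConnected) (hγ : PiecewiseLocLipOn γ I) :
    ∀ᵐ t, t ∈ I → ∃ L, HasMetricDerivWithinAt γ I t L := by
  obtain ⟨-, S, hS⟩ := hγ
  have hSnull : ∀ᵐ t : ℝ, t ∉ (S : Set ℝ) :=
    measure_eq_zero_iff_ae_notMem.1 (S.finite_toSet.measure_zero volume)
  suffices h : volume {t | I \ S ∈ 𝓝 t ∧ ¬ ∃ L, HasMetricDerivWithinAt γ I t L} = 0 by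
    filter_upwards [hI.ae_mem_nhds, hSnull, measure_eq_zero_iff_ae_notMem.1 h] with t h1 h2 h3 htI
    by_contra hn
    exact h3 ⟨inter_mem (h1 htI) (S.finite_toSet.isClosed.isOpen_compl.mem_nhds h2), hn⟩
  refine measure_null_of_locally_null _ fun x hx => ?_
  obtain ⟨hxI, -⟩ := hx
  obtain ⟨ε, hε, C, hC⟩ := hS x (mem_of_mem_nhds hxI)
  obtain ⟨δ, hδ, hδI⟩ := Metric.nhds_basis_closedBall.mem_iff.1
    (inter_mem hxI (Metric.ball_mem_nhds x hε))
  rw [Real.closedBall_eq_Icc] at hδI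
  have hle : x - δ ≤ x + δ := by linarith
  have hLip : LipschitzWith C (fun t => γ (projIcc (x - δ) (x + δ) hle t)) := by
    have := (hC.mono hδI).to_restrict.comp (LipschitzWith.projIcc hle)
    simpa [Function.comp_def] using this
  have hnull := measure_eq_zero_iff_ae_notMem.2
    (hLip.ae_exists_tendsto_dist_div.mono fun t ht => not_not.2 ht)
  refine ⟨_, ?_, hnull⟩
  have hball : Ioo (x - δ) (x + δ) ∈ 𝓝 x := Ioo_mem_nhds (by linarith) (by linarith)
  filter_upwards [self_mem_nhdsWithin, mem_nhdsWithin_of_mem_nhds hball] with t ht htδ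
  refine fun hex => ht.2 (hex.imp fun L hL => ?_)
  have heq : ∀ s ∈ Ioo (x - δ) (x + δ), γ (projIcc (x - δ) (x + δ) hle s) = γ s := fun s hs => by
    rw [projIcc_of_mem hle (Ioo_subset_Icc_self hs)]
  refine (hL.congr' ?_).mono_left (nhdsWithin_mono _ fun s hs => hs.2)
  filter_upwards [mem_nhdsWithin_of_mem_nhds (isOpen_Ioo.mem_nhds htδ)] with s hs
  rw [heq s hs, heq t htδ]

end MetricDerivative

section FundamentalTheorem

theorem LocallyLipschitzOnSet.locallyLipschitzOn {X : Type*} [MetricSpace X] {γ : ℝ → X}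
    {s : Set ℝ} (h : LocallyLipschitzOnSet γ s) : LocallyLipschitzOn s γ := fun t ht => by
  obtain ⟨ε, hε, C, hC⟩ := h t ht
  exact ⟨C, _, inter_mem self_mem_nhdsWithin
    (mem_nhdsWithin_of_mem_nhds (Metric.ball_mem_nhds t hε)), hC⟩

/-- The increment of a continuous function that is locally Lipschitz outside a finite set is
bounded by the (possibly infinite) integral of its derivative. -/
theorem edist_le_lintegral_enorm_deriv {ψ : ℝ → ℝ} (S : Finset ℝ) :
    ∀ {a b : ℝ}, a ≤ b → ContinuousOn ψ (Icc a b) →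
      LocallyLipschitzOn (Icc a b \ (S : Set ℝ)) ψ →
      edist (ψ a) (ψ b) ≤ ∫⁻ t in Icc a b, ‖deriv ψ t‖ₑ := by
  induction S using Finset.induction_on with
  | empty =>
    intro a b hab _ hL
    simp only [Finset.coe_empty, sdiff_empty] at hL
    obtain ⟨C, hC⟩ := hL.exists_lipschitzOnWith_of_compact isCompact_Icc
    rw [← uIcc_of_le hab] at hC
    rw [edist_comm, edist_eq_enorm_sub, ← hC.absolutelyContinuousOnInterval.integral_deriv_eq_sub,
      intervalIntegral.integral_of_le hab, ← integral_Icc_eq_integral_Ioc]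
    exact enorm_integral_le_lintegral_enorm _
  | insert s S _ ih =>
    intro a b hab hc hL
    by_cases hs : s ∈ Icc a b
    · have hleft : edist (ψ a) (ψ s) ≤ ∫⁻ t in Ioc a s, ‖deriv ψ t‖ₑ := by
        rcases hs.1.eq_or_lt with rfl | has
        · simp
        have htend : Tendsto (fun s' => edist (ψ a) (ψ s')) (𝓝[Ico a s] s)
            (𝓝 (edist (ψ a) (ψ s))) :=
          tendsto_const_nhds.edist ((hc s hs).mono fun x hx => ⟨hx.1, hx.2.le.trans hs.2⟩)
        have : (𝓝[Ico a s] s).NeBot := by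
          rw [nhdsWithin_Ico_eq_nhdsLT has]; infer_instance
        refine le_of_tendsto htend (eventually_mem_nhdsWithin.mono fun s' hs' => ?_)
        refine (ih hs'.1 (hc.mono (Icc_subset_Icc_right (hs'.2.le.trans hs.2)))
          (hL.mono fun x hx => ⟨⟨hx.1.1, hx.1.2.trans (hs'.2.le.trans hs.2)⟩, ?_⟩)).trans ?_
        · rw [Finset.coe_insert, mem_insert_iff, not_or]
          exact ⟨(hx.1.2.trans_lt hs'.2).ne, hx.2⟩
        · rw [setLIntegral_congr Ioc_ae_eq_Icc.symm]
          exact lintegral_mono_set (Ioc_subset_Ioc_right hs'.2.le)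
      have hright : edist (ψ s) (ψ b) ≤ ∫⁻ t in Ioc s b, ‖deriv ψ t‖ₑ := by
        rcases hs.2.eq_or_lt with rfl | hsb
        · simp
        have htend : Tendsto (fun s' => edist (ψ s') (ψ b)) (𝓝[Ioc s b] s)
            (𝓝 (edist (ψ s) (ψ b))) :=
          Tendsto.edist ((hc s hs).mono fun x hx => ⟨hs.1.trans hx.1.le, hx.2⟩)
            tendsto_const_nhds
        have : (𝓝[Ioc s b] s).NeBot := by
          rw [nhdsWithin_Ioc_eq_nhdsGT hsb]; infer_instance
        refine le_of_tendsto htend (eventually_mem_nhdsWithin.mono fun s' hs' => ?_)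
        refine (ih hs'.2 (hc.mono (Icc_subset_Icc_left (hs.1.trans hs'.1.le)))
          (hL.mono fun x hx => ⟨⟨(hs.1.trans hs'.1.le).trans hx.1.1, hx.1.2⟩, ?_⟩)).trans ?_
        · rw [Finset.coe_insert, mem_insert_iff, not_or]
          exact ⟨(hs'.1.trans_le hx.1.1).ne', hx.2⟩
        · exact lintegral_mono_set fun x hx => ⟨hs'.1.trans_le hx.1, hx.2⟩
      calc edist (ψ a) (ψ b) ≤ edist (ψ a) (ψ s) + edist (ψ s) (ψ b) := edist_triangle _ _ _
        _ ≤ (∫⁻ t in Ioc a s, ‖deriv ψ t‖ₑ) + ∫⁻ t in Ioc s b, ‖deriv ψ t‖ₑ :=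
          add_le_add hleft hright
        _ = ∫⁻ t in Icc a b, ‖deriv ψ t‖ₑ := by
          rw [← lintegral_union measurableSet_Ioc (Ioc_disjoint_Ioc_of_le le_rfl),
            Ioc_union_Ioc_eq_Ioc hs.1 hs.2, setLIntegral_congr Ioc_ae_eq_Icc]
    · refine ih hab hc (hL.mono fun x hx => ⟨hx.1, ?_⟩)
      rw [Finset.coe_insert, mem_insert_iff, not_or]
      exact ⟨fun h => hs (h ▸ hx.1), hx.2⟩

end FundamentalTheorem

section WeightedDistance

variable {X : Type*} [MetricSpace X]

theorem leftEndFilter_le_principal (I : Set ℝ) : leftEndFilter I ≤ 𝓟 I := by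
  unfold leftEndFilter
  split_ifs
  exacts [inf_le_right, inf_le_right]

theorem rightEndFilter_le_principal (I : Set ℝ) : rightEndFilter I ≤ 𝓟 I := by
  unfold rightEndFilter
  split_ifs
  exacts [inf_le_right, inf_le_right]

theorem leftEndFilter_neBot {I : Set ℝ} (hI : I.Nonempty) : (leftEndFilter I).NeBot := by
  unfold leftEndFilter
  split_ifs with h
  · exact mem_closure_iff_nhdsWithin_neBot.1 (csInf_mem_closure hI h)
  · refine frequently_mem_iff_neBot.1 (frequently_atBot.2 fun a => ?_)
    obtain ⟨b, hb, hba⟩ := not_bddBelow_iff.1 h a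
    exact ⟨b, hba.le, hb⟩

theorem rightEndFilter_neBot {I : Set ℝ} (hI : I.Nonempty) : (rightEndFilter I).NeBot := by
  unfold rightEndFilter
  split_ifs with h
  · exact mem_closure_iff_nhdsWithin_neBot.1 (csSup_mem_closure hI h)
  · refine frequently_mem_iff_neBot.1 (frequently_atTop.2 fun a => ?_)
    obtain ⟨b, hb, hba⟩ := not_bddAbove_iff.1 h a
    exact ⟨b, hba.le, hb⟩

theorem LocallyLipschitzOnSet.comp_lipschitzWith {γ : ℝ → X} {s : Set ℝ}
    (h : LocallyLipschitzOnSet γ s) {f : X → ℝ} {C : ℝ≥0} (hf : LipschitzWith C f) :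
    LocallyLipschitzOnSet (fun t => f (γ t)) s := fun t ht => by
  obtain ⟨ε, hε, D, hD⟩ := h t ht
  exact ⟨ε, hε, C * D, hf.comp_lipschitzOnWith hD⟩

theorem HasMetricDerivWithinAt.abs_deriv_comp_le {γ : ℝ → X} {I : Set ℝ} {t L : ℝ}
    (hI : I ∈ 𝓝 t) (h : HasMetricDerivWithinAt γ I t L) {f : X → ℝ} (hf : LipschitzWith 1 f) :
    |deriv (fun s => f (γ s)) t| ≤ L := by
  by_cases hd : DifferentiableAt ℝ (fun s => f (γ s)) t
  · refine le_of_tendsto_of_tendsto' (hd.hasDerivAt.tendsto_slope).abs (h.tendsto hI) fun s => ?_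
    rw [slope_def_field, abs_div]
    gcongr
    simpa [Real.dist_eq] using hf.dist_le_mul (γ s) (γ t)
  · rw [deriv_zero_of_not_differentiableAt hd, abs_zero]
    exact h.nonneg hI

/-- If `K ≥ c` on the ball of radius `r` around `y`, then the `K`-length of a path ending at `y`
controls the increments of the distance to `y`, truncated at height `r`. -/
theorem ofReal_mul_abs_truncated_dist_sub_le_KLength [SecondCountableTopology X] {K : X → ℝ}
    (hK0 : ∀ x, 0 ≤ K x) {y : X} {c r : ℝ} (hc : 0 ≤ c)
    (hcK : ∀ z ∈ Metric.closedBall y r, c ≤ K z) {γ : ℝ → X} {I : Set ℝ} (hI : I.OrdConnected)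
    (hγ : PiecewiseLocLipOn γ I) {a b : ℝ} (ha : a ∈ I) (hb : b ∈ I) (hab : a ≤ b) :
    ENNReal.ofReal (c * |min (dist (γ a) y) r - min (dist (γ b) y) r|) ≤ KLength K γ I := by
  set f : X → ℝ := fun x => min (dist x y) r with hf
  have hfL : LipschitzWith 1 f := (LipschitzWith.dist_left y).min_const r
  obtain ⟨S, hS⟩ := hγ.2
  have hsub : Icc a b ⊆ I := hI.out ha hb
  have hinc : edist (f (γ a)) (f (γ b)) ≤ ∫⁻ t in Icc a b, ‖deriv (fun s => f (γ s)) t‖ₑ := by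
    refine edist_le_lintegral_enorm_deriv (ψ := fun s => f (γ s)) S hab
      (hfL.continuous.comp_continuousOn (hγ.1.mono hsub)) ?_
    exact (hS.comp_lipschitzWith hfL).locallyLipschitzOn.mono (sdiff_subset_sdiff_left hsub)
  calc ENNReal.ofReal (c * |f (γ a) - f (γ b)|)
      = ENNReal.ofReal c * edist (f (γ a)) (f (γ b)) := by
        rw [ENNReal.ofReal_mul hc, edist_dist, Real.dist_eq]
    _ ≤ ENNReal.ofReal c * ∫⁻ t in Icc a b, ‖deriv (fun s => f (γ s)) t‖ₑ := by gcongr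
    _ = ∫⁻ t in Icc a b, ENNReal.ofReal c * ‖deriv (fun s => f (γ s)) t‖ₑ :=
        (lintegral_const_mul' _ _ ENNReal.ofReal_ne_top).symm
    _ ≤ ∫⁻ t in Icc a b, ENNReal.ofReal (K (γ t) * metricDerivWithin γ I t) := by
        refine setLIntegral_mono_ae' measurableSet_Icc ?_
        filter_upwards [hI.ae_mem_nhds, hγ.ae_exists_hasMetricDerivWithinAt hI] with t hnhds hex ht
        have htI := hnhds (hsub ht)
        have hder := hasMetricDerivWithinAt_metricDerivWithin (hex (hsub ht))
        have hle := hder.abs_deriv_comp_le htI hfL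
        rw [← ofReal_norm, Real.norm_eq_abs, ← ENNReal.ofReal_mul hc]
        refine ENNReal.ofReal_le_ofReal ?_
        rcases le_or_gt (dist (γ t) y) r with hle' | hgt
        · exact mul_le_mul (hcK _ hle') hle (abs_nonneg _) (hK0 _)
        · have hcont : ContinuousAt (fun s => dist (γ s) y) t :=
            (hγ.1.continuousAt htI).dist continuousAt_const
          have hconst : (fun s => f (γ s)) =ᶠ[𝓝 t] fun _ => r := by
            filter_upwards [hcont.eventually (lt_mem_nhds hgt)] with s hs
            exact min_eq_right hs.le
          rw [hconst.deriv_eq, deriv_const, abs_zero, mul_zero]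
          exact mul_nonneg (hK0 _) (hder.nonneg htI)
    _ ≤ KLength K γ I := lintegral_mono_set hsub

/-- Local lower bound of `d_K` in terms of the original distance. -/
theorem ofReal_mul_min_dist_le_dK [SecondCountableTopology X] {K : X → ℝ}
    (hK0 : ∀ x, 0 ≤ K x) {x y : X} {c r : ℝ} (hc : 0 ≤ c) (hr : 0 ≤ r)
    (hcK : ∀ z ∈ Metric.closedBall y r, c ≤ K z) :
    ENNReal.ofReal (c * min (dist x y) r) ≤ dK K x y := by
  refine le_iInf fun γ => le_iInf fun I => le_iInf fun hγ => le_iInf fun hpath => ?_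
  obtain ⟨hne, hI, -, hleft, hright⟩ := hpath
  have := leftEndFilter_neBot hne
  have := rightEndFilter_neBot hne
  have hbound : ∀ a ∈ I, ∀ b ∈ I,
      ENNReal.ofReal (c * |min (dist (γ a) y) r - min (dist (γ b) y) r|) ≤ KLength K γ I := by
    intro a ha b hb
    rcases le_total a b with hab | hab
    · exact ofReal_mul_abs_truncated_dist_sub_le_KLength hK0 hc hcK hI hγ ha hb hab
    · rw [abs_sub_comm]
      exact ofReal_mul_abs_truncated_dist_sub_le_KLength hK0 hc hcK hI hγ hb ha hab
  have hlim : ∀ a ∈ I, ENNReal.ofReal (c * min (dist (γ a) y) r) ≤ KLength K γ I := by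
    intro a ha
    have hcont : Continuous fun z : X =>
        ENNReal.ofReal (c * |min (dist (γ a) y) r - min (dist z y) r|) :=
      ENNReal.continuous_ofReal.comp (by fun_prop)
    have h := (hcont.tendsto y).comp hright
    have h' := le_of_tendsto h
      (rightEndFilter_le_principal I (mem_principal.2 fun b hb => hbound a ha b hb))
    rwa [dist_self, min_eq_left hr, sub_zero, abs_of_nonneg (le_min dist_nonneg hr)] at h'
  have hcont : Continuous fun z : X => ENNReal.ofReal (c * min (dist z y) r) :=
      ENNReal.continuous_ofReal.comp (by fun_prop)
  exact le_of_tendsto ((hcont.tendsto x).comp hleft)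
    (leftEndFilter_le_principal I (mem_principal.2 hlim))

end WeightedDistance

section Lengths

variable {X : Type*} [MetricSpace X]

theorem metricDerivWithin_comp_neg {γ : ℝ → X} {I J : Set ℝ} {t : ℝ} (hI : I ∈ 𝓝 (-t))
    (hJ : J ∈ 𝓝 t) :
    metricDerivWithin (fun s => γ (-s)) J t = metricDerivWithin γ I (-t) := by
  have hmap : map Neg.neg (𝓝[≠] t) = 𝓝[≠] (-t) := by
    have h := (Homeomorph.neg ℝ).isEmbedding.map_nhdsWithin_eq {t}ᶜ t
    rw [Homeomorph.coe_neg, image_compl_eq neg_bijective, image_singleton] at h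
    exact h
  have h : HasMetricDerivWithinAt (fun s => γ (-s)) J t = HasMetricDerivWithinAt γ I (-t) := by
    ext L
    rw [HasMetricDerivWithinAt, HasMetricDerivWithinAt, nhdsWithin_sdiff_singleton_of_mem_nhds hI,
      nhdsWithin_sdiff_singleton_of_mem_nhds hJ, ← hmap, tendsto_map'_iff]
    refine tendsto_congr fun s => ?_
    rw [Function.comp_apply, neg_sub_neg, abs_sub_comm]
  unfold metricDerivWithin
  rw [h]

/-- The restriction of `γ` to a compact interval, run backwards, bounds `d_K`. -/
theorem dK_le_lintegral {K : X → ℝ} {γ : ℝ → X} {I : Set ℝ} (hI : I.OrdConnected)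
    (hγ : PiecewiseLocLipOn γ I) {a b : ℝ} (ha : a ∈ I) (hb : b ∈ I) (hab : a ≤ b) :
    dK K (γ b) (γ a) ≤
      ∫⁻ t in Ioc a b, ENNReal.ofReal (K (γ t) * metricDerivWithin γ I t) := by
  have hsub : Icc a b ⊆ I := hI.out ha hb
  have hmaps : MapsTo Neg.neg (Icc (-b) (-a)) (Icc a b) := fun t ht =>
    ⟨by linarith [ht.2], by linarith [ht.1]⟩
  have hba : -b ≤ -a := neg_le_neg hab
  have hcont : ContinuousOn (fun t => γ (-t)) (Icc (-b) (-a)) :=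
    hγ.1.comp continuousOn_neg (hmaps.mono_right hsub)
  have hpl : PiecewiseLocLipOn (fun t => γ (-t)) (Icc (-b) (-a)) := by
    obtain ⟨S, hS⟩ := hγ.2
    have hm : ∀ t ∈ Icc (-b) (-a) \ ((S.image Neg.neg : Finset ℝ) : Set ℝ),
        -t ∈ I \ (S : Set ℝ) := fun t ht =>
      ⟨hsub (hmaps ht.1), fun h => ht.2 (by simpa using h)⟩
    refine ⟨hcont, S.image Neg.neg, fun t ht => ?_⟩
    obtain ⟨ε, hε, C, hC⟩ := hS (-t) (hm t ht)
    refine ⟨ε, hε, C, fun x hx y hy => ?_⟩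
    have h := hC (x := -x) ⟨hm x hx.1, by simpa [dist_neg_neg] using hx.2⟩
      (y := -y) ⟨hm y hy.1, by simpa [dist_neg_neg] using hy.2⟩
    simpa only [edist_neg_neg] using h
  have hpath : IsPathOn (fun t => γ (-t)) (Icc (-b) (-a)) (γ b) (γ a) := by
    refine ⟨nonempty_Icc.2 hba, ordConnected_Icc, hcont, ?_, ?_⟩
    · rw [leftEndFilter, if_pos bddBelow_Icc, csInf_Icc hba]
      simpa [ContinuousWithinAt] using hcont (-b) (left_mem_Icc.2 hba)
    · rw [rightEndFilter, if_pos bddAbove_Icc, csSup_Icc hba]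
      simpa [ContinuousWithinAt] using hcont (-a) (right_mem_Icc.2 hba)
  refine (iInf₂_le_of_le _ _ (iInf₂_le hpl hpath)).trans (le_of_eq ?_)
  have hpre : Ioo (-b) (-a) = Neg.neg ⁻¹' Ioo a b := by simp
  rw [KLength, setLIntegral_congr Ioo_ae_eq_Icc.symm, setLIntegral_congr Ioo_ae_eq_Ioc.symm,
    ← (Measure.measurePreserving_neg (volume : Measure ℝ)).setLIntegral_comp_preimage_emb
      (MeasurableEquiv.neg ℝ).measurableEmbedding _ (Ioo a b), ← hpre]
  refine setLIntegral_congr_fun measurableSet_Ioo fun t ht => ?_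
  have htI : I ∈ 𝓝 (-t) := mem_of_superset
    (Icc_mem_nhds (a := a) (b := b) (by linarith [ht.2]) (by linarith [ht.1])) hsub
  simp only [metricDerivWithin_comp_neg htI (Icc_mem_nhds ht.1 ht.2)]

theorem dKVariationOn_le_KLength {K : X → ℝ} {γ : ℝ → X} {I : Set ℝ} (hI : I.OrdConnected)
    (hγ : PiecewiseLocLipOn γ I) : dKVariationOn K γ I ≤ KLength K γ I := by
  refine iSup_le fun ⟨n, u, hu, huI⟩ => ?_
  have hsum : ∑ i ∈ Finset.range n, dK K (γ (u (i + 1))) (γ (u i)) ≤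
      ∫⁻ t in Ioc (u 0) (u n), ENNReal.ofReal (K (γ t) * metricDerivWithin γ I t) := by
    induction n with
    | zero => simp
    | succ n ih =>
      rw [Finset.sum_range_succ, ← Ioc_union_Ioc_eq_Ioc (hu n.zero_le) (hu n.le_succ),
        lintegral_union measurableSet_Ioc (Ioc_disjoint_Ioc_of_le le_rfl)]
      exact add_le_add ih (dK_le_lintegral hI hγ (huI n) (huI (n + 1)) (hu n.le_succ))
  exact hsum.trans (lintegral_mono_set (Ioc_subset_Icc_self.trans (hI.out (huI 0) (huI n))))

theorem dKVariationOn_mono (K : X → ℝ) (γ : ℝ → X) {s t : Set ℝ} (h : s ⊆ t) :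
    dKVariationOn K γ s ≤ dKVariationOn K γ t :=
  iSup_le fun ⟨n, u, hu, hus⟩ =>
    le_iSup_of_le ⟨n, u, hu, fun i => h (hus i)⟩ le_rfl

theorem dKVariationOn_inter_Iic_add_dK_le (K : X → ℝ) (γ : ℝ → X) {I : Set ℝ} {s t : ℝ}
    (hs : s ∈ I) (ht : t ∈ I) (hst : s ≤ t) :
    dKVariationOn K γ (I ∩ Iic s) + dK K (γ t) (γ s) ≤ dKVariationOn K γ (I ∩ Iic t) := by
  have : Nonempty (ℕ × { u : ℕ → ℝ // Monotone u ∧ ∀ i, u i ∈ I ∩ Iic s }) :=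
    ⟨0, fun _ => s, monotone_const, fun _ => ⟨hs, self_mem_Iic⟩⟩
  rw [dKVariationOn, ENNReal.iSup_add]
  refine iSup_le fun ⟨n, u, hu, hus⟩ => ?_
  set v : ℕ → ℝ := fun i => if i ≤ n then u i else if i = n + 1 then s else t with hv
  have hvm : Monotone v := by
    refine monotone_nat_of_le_succ fun i => ?_
    simp only [hv]
    have h1 := hu i.le_succ
    have h2 : u i ≤ s := (hus i).2
    split_ifs <;> first | omega | assumption | exact le_rfl
  have hvI : ∀ i, v i ∈ I ∩ Iic t := fun i => by
    simp only [hv]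
    split_ifs
    exacts [⟨(hus i).1, (hus i).2.trans hst⟩, ⟨hs, hst⟩, ⟨ht, self_mem_Iic⟩]
  refine le_trans ?_ (le_iSup (fun p : ℕ × { u : ℕ → ℝ // Monotone u ∧ ∀ i, u i ∈ I ∩ Iic t } =>
    ∑ i ∈ Finset.range p.1, dK K (γ (p.2.1 (i + 1))) (γ (p.2.1 i))) ⟨n + 2, v, hvm, hvI⟩)
  have hv1 : v (n + 1) = s := by simp [hv]
  have hv2 : v (n + 1 + 1) = t := by simp [hv]
  have hsum : ∑ i ∈ Finset.range n, dK K (γ (v (i + 1))) (γ (v i)) =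
      ∑ i ∈ Finset.range n, dK K (γ (u (i + 1))) (γ (u i)) := by
    refine Finset.sum_congr rfl fun i hi => ?_
    have hi' := Finset.mem_range.1 hi
    simp only [hv, if_pos hi'.le, if_pos (Nat.succ_le_of_lt hi')]
  dsimp only
  rw [Finset.sum_range_succ, hv1, hv2, Finset.sum_range_succ, hsum]
  exact add_le_add le_self_add le_rfl

/-- The total mass of the Stieltjes measure of a monotone function is at most its oscillation. -/
theorem Monotone.stieltjesFunction_measure_univ_le {F : ℝ → ℝ} (hF : Monotone F) {l u : ℝ}
    (hl : ∀ t, l ≤ F t) (hu : ∀ t, F t ≤ u) :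
    hF.stieltjesFunction.measure univ ≤ ENNReal.ofReal (u - l) := by
  have hl' : ∀ t, l ≤ hF.stieltjesFunction t := fun t => (hl t).trans (hF.le_rightLim le_rfl)
  have hu' : ∀ t, hF.stieltjesFunction t ≤ u := fun t =>
    (hF.rightLim_le (lt_add_one t)).trans (hu _)
  rw [StieltjesFunction.measure_univ _
    (tendsto_atBot_ciInf hF.stieltjesFunction.mono ⟨l, by rintro _ ⟨t, rfl⟩; exact hl' t⟩)
    (tendsto_atTop_ciSup hF.stieltjesFunction.mono ⟨u, by rintro _ ⟨t, rfl⟩; exact hu' t⟩)]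
  exact ENNReal.ofReal_le_ofReal (sub_le_sub (ciSup_le hu') (le_ciInf hl'))

/-- The derivative of a function whose increments dominate `d_K` along `γ` is at least
`K (γ t) * |γ̇| t`. -/
theorem mul_metricDerivWithin_le_of_dK_le [SecondCountableTopology X] {K : X → ℝ}
    (hKc : Continuous K) (hK0 : ∀ x, 0 ≤ K x) {γ : ℝ → X} {I : Set ℝ} {t D : ℝ} (hI : I ∈ 𝓝 t)
    (hγ : ContinuousAt γ t) {F : ℝ → ℝ} (hF : HasDerivAt F D t) (hD : 0 ≤ D)
    (hinc : ∀ s ∈ I, t ≤ s → dK K (γ s) (γ t) ≤ ENNReal.ofReal (F s - F t))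
    (hmono : Monotone F) :
    K (γ t) * metricDerivWithin γ I t ≤ D := by
  by_cases hex : ∃ L, HasMetricDerivWithinAt γ I t L
  swap
  · rwa [metricDerivWithin, dif_neg hex, mul_zero]
  have hder := hasMetricDerivWithinAt_metricDerivWithin hex
  have hL := metricDerivWithin_nonneg (γ := γ) hI
  set L := metricDerivWithin γ I t
  have hlower : ∀ c < K (γ t), c * L ≤ D := by
    intro c hcK
    rcases le_or_gt c 0 with hc | hc
    · exact (mul_nonpos_of_nonpos_of_nonneg hc hL).trans hD
    obtain ⟨r, hr, hball⟩ := Metric.nhds_basis_closedBall.mem_iff.1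
      (hKc.continuousAt.eventually (lt_mem_nhds hcK))
    have hgt : 𝓝[>] t ≤ 𝓝[≠] t := nhdsWithin_mono _ fun s hs => ne_of_gt hs
    refine le_of_tendsto_of_tendsto (((hder.tendsto hI).mono_left hgt).const_mul c)
      (hF.tendsto_slope.mono_left hgt) ?_
    filter_upwards [self_mem_nhdsWithin, mem_nhdsWithin_of_mem_nhds hI,
      mem_nhdsWithin_of_mem_nhds (hγ.eventually (Metric.ball_mem_nhds (γ t) hr))]
      with s hts hsI hsr
    have hts' : 0 < s - t := sub_pos.2 hts
    have h := (ofReal_mul_min_dist_le_dK (x := γ s) hK0 hc.le hr.le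
      fun z hz => (hball hz).le).trans (hinc s hsI (le_of_lt hts))
    rw [ENNReal.ofReal_le_ofReal_iff (sub_nonneg.2 (hmono (le_of_lt hts))),
      min_eq_left (le_of_lt hsr)] at h
    rw [slope_def_field, abs_of_pos hts', mul_div_assoc']
    gcongr
  have htend : Tendsto (fun c => c * L) (𝓝[<] K (γ t)) (𝓝 (K (γ t) * L)) :=
    (tendsto_id.mono_left nhdsWithin_le_nhds).mul_const L
  exact le_of_tendsto htend (eventually_mem_nhdsWithin.mono hlower)

theorem KLength_le_dKVariationOn [SecondCountableTopology X] {K : X → ℝ} (hKc : Continuous K)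
    (hK0 : ∀ x, 0 ≤ K x) {γ : ℝ → X} {I : Set ℝ} (hI : I.OrdConnected)
    (hγ : ContinuousOn γ I) : KLength K γ I ≤ dKVariationOn K γ I := by
  by_cases htop : dKVariationOn K γ I = ⊤
  · rw [htop]
    exact le_top
  have hle : ∀ t, dKVariationOn K γ (I ∩ Iic t) ≤ dKVariationOn K γ I := fun t =>
    dKVariationOn_mono K γ inter_subset_left
  have hfin : ∀ t, dKVariationOn K γ (I ∩ Iic t) ≠ ⊤ := fun t => ne_top_of_le_ne_top htop (hle t)
  set F : ℝ → ℝ := fun t => (dKVariationOn K γ (I ∩ Iic t)).toReal with hF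
  have hmono : Monotone F := fun s t hst => ENNReal.toReal_mono (hfin t)
    (dKVariationOn_mono K γ (inter_subset_inter_right I (Iic_subset_Iic.2 hst)))
  have hinc : ∀ t ∈ I, ∀ s ∈ I, t ≤ s → dK K (γ s) (γ t) ≤ ENNReal.ofReal (F s - F t) := by
    intro t ht s hs hts
    rw [ENNReal.ofReal_sub _ ENNReal.toReal_nonneg, ENNReal.ofReal_toReal (hfin s),
      ENNReal.ofReal_toReal (hfin t)]
    exact ENNReal.le_sub_of_add_le_left (hfin t) (dKVariationOn_inter_Iic_add_dK_le K γ ht hs hts)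
  set μ := hmono.stieltjesFunction.measure with hμ
  calc KLength K γ I ≤ ∫⁻ t in I, μ.rnDeriv volume t := by
        refine setLIntegral_mono_ae' hI.measurableSet ?_
        filter_upwards [hI.ae_mem_nhds, hmono.ae_hasDerivAt] with t hnhds hderiv ht
        exact (ENNReal.ofReal_le_ofReal (mul_metricDerivWithin_le_of_dK_le hKc hK0 (hnhds ht)
          (hγ.continuousAt (hnhds ht)) hderiv ENNReal.toReal_nonneg (hinc t ht) hmono)).trans
          ENNReal.ofReal_toReal_le
    _ ≤ ∫⁻ t, μ.rnDeriv volume t := setLIntegral_le_lintegral _ _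
    _ ≤ μ univ := Measure.lintegral_rnDeriv_le
    _ ≤ ENNReal.ofReal ((dKVariationOn K γ I).toReal - 0) :=
        hmono.stieltjesFunction_measure_univ_le (fun t => ENNReal.toReal_nonneg)
          fun t => ENNReal.toReal_mono htop (hle t)
    _ = dKVariationOn K γ I := by rw [sub_zero, ENNReal.ofReal_toReal htop]

end Lengths

/-- Under hypotheses (H1)-(H3), for every piecewise locally Lipschitz curve
`γ : I → X` one has `L_K(γ) = L_{d_K}(γ)`. -/
theorem KLength_eq_dK_length
    {X : Type*} [MetricSpace X] [ProperSpace X] (hlen : IsLengthSpace X)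
    (K : X → ℝ) (hKc : Continuous K) (hK0 : ∀ x, 0 ≤ K x)
    (hfin : {x : X | K x = 0}.Finite)
    (k : ℝ → ℝ) (hkc : ContinuousOn k (Set.Ici 0)) (hk0 : ∀ t ∈ Set.Ici (0 : ℝ), 0 ≤ k t)
    (hkdiv : ∫⁻ t in Set.Ioi (0 : ℝ), ENNReal.ofReal (k t) = ⊤)
    (hlow : ∀ x : X, k (Metric.infDist x {x : X | K x = 0}) ≤ K x)
    (γ : ℝ → X) (I : Set ℝ) (hne : I.Nonempty) (hint : I.OrdConnected)
    (hγ : PiecewiseLocLipOn γ I) :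
    KLength K γ I = dKVariationOn K γ I := by
  exact le_antisymm (KLength_le_dKVariationOn hKc hK0 hint hγ.1)
    (dKVariationOn_le_KLength hint hγ)
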